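/- arXiv:2004.09092 — 2 statements merged into one kernel-verified Lean document; each statement's English description precedes it below -/
import Mathlib

section
/- Let a, b be integers with 1 ≤ a < b, and let p/q and p'/q' be rational numbers in [0,1] with p/q < p'/q'. Then L(α_{p/q}) < L(α_{p'/q'}), where α_{p/q} = [0; overline{w_{p/q}}] is the real number whose sequence of partial quotients is the purely periodic word obtained by repeating the lower Christoffel word w_{p/q}. -/
open Filter Real Matrix

noncomputable section

/-- `contQ w n` is the denominator `Q n` of the `n`-th convergent of the
continued fraction `[0; w 1, w 2, …]`. -/
def contQ (w : ℕ → ℕ) : ℕ → ℕ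
  | 0 => 1
  | 1 => w 1
  | n + 2 => w (n + 2) * contQ w (n + 1) + contQ w n

/-- The real number `[0; w 1, w 2, …]` has Lévy constant `ℓ`, i.e. the sequence
`(log Q n)/n` converges to `ℓ`. -/
def HasLevyConstant (w : ℕ → ℕ) (ℓ : ℝ) : Prop :=
  Tendsto (fun n : ℕ => Real.log (contQ w n) / n) atTop (nhds ℓ)

/-- `L` is a (finite) factor of the infinite word `w = w 1 w 2 ⋯`. -/
def IsFactorSeq (w : ℕ → ℕ) (L : List ℕ) : Prop :=
  ∃ i : ℕ, L = (List.range L.length).map fun j => w (i + j + 1)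

/-- The complexity function `p(n, w)`: the number of distinct factors of length `n`. -/
def complexity (w : ℕ → ℕ) (n : ℕ) : ℕ :=
  Set.ncard {L : List ℕ | L.length = n ∧ IsFactorSeq w L}

/-- The mechanical word `s_{θ,ρ}` over `{a,b}` (floor version), indexed from `1`. -/
def mechWord (a b : ℕ) (θ ρ : ℝ) (n : ℕ) : ℕ :=
  if ⌊(n : ℝ) * θ + ρ⌋ - ⌊((n : ℝ) - 1) * θ + ρ⌋ = 0 then a else b

/-- The mechanical word `s'_{θ,ρ}` over `{a,b}` (ceiling version), indexed from `1`. -/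
def mechWord' (a b : ℕ) (θ ρ : ℝ) (n : ℕ) : ℕ :=
  if ⌈(n : ℝ) * θ + ρ⌉ - ⌈((n : ℝ) - 1) * θ + ρ⌉ = 0 then a else b

/-- `w` is a Sturmian word over `{a, b}`: a mechanical word with irrational slope. -/
def IsSturmianWord (a b : ℕ) (w : ℕ → ℕ) : Prop :=
  ∃ θ ρ : ℝ, Irrational θ ∧ θ ∈ Set.Icc (0 : ℝ) 1 ∧ ρ ∈ Set.Ico (0 : ℝ) 1 ∧
    (w = mechWord a b θ ρ ∨ w = mechWord' a b θ ρ)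

/-- The matrix `[[x, 1], [1, 0]]`. -/
def cfMat (x : ℝ) : Matrix (Fin 2) (Fin 2) ℝ := !![x, 1; 1, 0]

/-- `T(b₁, …, b_n)`: the trace of `[[b₁,1],[1,0]] ⋯ [[b_n,1],[1,0]]` for a word
`b₁ ⋯ b_n` over the positive integers.  The trace of the empty word is `2`. -/
def traceWord (L : List ℕ) : ℝ := ((L.map fun c => cfMat (c : ℝ)).prod).trace

/-- The polynomial `𝐓_n(x) = Tr([[x,1],[1,0]]^n)`. -/
def Tpoly (n : ℕ) (x : ℝ) : ℝ := ((cfMat x) ^ n).trace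

/-- The lower Christoffel word `w_{p/q}` over `{a, b}`: the prefix of length `q`
of the mechanical word `s_{p/q, 0}`. -/
def christoffel (a b p q : ℕ) : List ℕ :=
  (List.range q).map fun n => mechWord a b ((p : ℝ) / (q : ℝ)) 0 (n + 1)

/-- `T(w_{p/q})`, the trace attached to the lower Christoffel word of slope `p/q`. -/
def Tw (a b p q : ℕ) : ℝ := traceWord (christoffel a b p q)

/-- The continuant `K(b₁, …, b_n)`: the denominator of `[0; b₁, …, b_n]`. -/
def contList : List ℕ → ℕ
  | [] => 1
  | [x] => x
  | x :: y :: t => x * contList (y :: t) + contList t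

/-- The standard words attached to `d₁, d₂, …` : `sturmM a b d (k+1)` is the word
`M_k`, where `M_{-1} = b`, `M_0 = a` and `M_k = M_{k-1}^{d_k} M_{k-2}`. -/
def sturmM (a b : ℕ) (d : ℕ → ℕ) : ℕ → List ℕ
  | 0 => [b]
  | 1 => [a]
  | k + 2 => (List.replicate (d (k + 1)) (sturmM a b d (k + 1))).flatten ++ sturmM a b d k

/-- Denominators `q_k` of the convergents of `θ = [0; 1 + d₁, d₂, d₃, …]`. -/
def cfQ (d : ℕ → ℕ) : ℕ → ℕ
  | 0 => 1
  | 1 => 1 + d 1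
  | k + 2 => d (k + 2) * cfQ d (k + 1) + cfQ d k

/-- Numerators `p_k` of the convergents of `θ = [0; 1 + d₁, d₂, d₃, …]`. -/
def cfP (d : ℕ → ℕ) : ℕ → ℕ
  | 0 => 0
  | 1 => 1
  | k + 2 => d (k + 2) * cfP d (k + 1) + cfP d k

/-- `w` is ultimately periodic (so that `[0; w 1, w 2, …]` is a quadratic irrational). -/
def UltimatelyPeriodic (w : ℕ → ℕ) : Prop :=
  ∃ r s : ℕ, 0 < s ∧ ∀ n, r < n → w (n + s) = w n

end

/-- The square root of the discriminant of `X² - x X + d`. -/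
noncomputable def discRoot (d x : ℝ) : ℝ := √(x ^ 2 - 4 * d)

/-- The logarithm of the larger root of `X² - x X + d`. -/
noncomputable def logRoot (d x : ℝ) : ℝ := Real.log ((x + discRoot d x) / 2)

lemma discRoot_pos {d x : ℝ} (h : 4 * d < x ^ 2) : 0 < discRoot d x :=
  Real.sqrt_pos.2 (by linarith)

lemma discRoot_sq {d x : ℝ} (h : 4 * d < x ^ 2) : discRoot d x ^ 2 = x ^ 2 - 4 * d :=
  Real.sq_sqrt (by linarith)

lemma exists_root {d x : ℝ} (hd : d = 1 ∨ d = -1) (hx : 0 < x) (h : 4 * d < x ^ 2) :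
    ∃ u : ℝ, 1 < u ∧ logRoot d x = Real.log u ∧ x = u + d / u ∧ discRoot d x = u - d / u := by
  have hR := discRoot_pos h
  have hR2 := discRoot_sq h
  set R := discRoot d x with hRdef
  have hu : 1 < (x + R) / 2 := by
    rcases hd with rfl | rfl
    · nlinarith
    · nlinarith
  have hu0 : (x + R) / 2 ≠ 0 := by positivity
  have hdu : d / ((x + R) / 2) = (x - R) / 2 := by
    rw [div_eq_iff hu0]; linarith
  refine ⟨(x + R) / 2, hu, rfl, ?_, ?_⟩ <;> rw [hdu] <;> ring

lemma log_sub_log_le_of_add_inv {P w D : ℝ} (hP : 1 < P) (hw : 1 < w)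
    (h : P + 1 / P - (w + 1 / w) ≤ D) (h0 : 0 ≤ P + 1 / P - (w + 1 / w)) :
    0 ≤ Real.log P - Real.log w ∧ Real.log P - Real.log w ≤ D / (w - 1 / w) := by
  have hP0 : 0 < P := by linarith
  have hw0 : 0 < w := by linarith
  have hwP : w ≤ P := by
    by_contra hc
    have hfac : P + 1 / P - (w + 1 / w) = (P - w) * (1 - 1 / (P * w)) := by
      field_simp; ring
    have : 1 / (P * w) < 1 := by
      rw [div_lt_one (by positivity)]; nlinarith
    rw [hfac] at h0
    nlinarith [not_le.1 hc]
  have hR : 0 < w - 1 / w := by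
    have : 1 / w < 1 := by rw [div_lt_one hw0]; exact hw
    linarith
  have hlog : Real.log P - Real.log w = Real.log (P / w) :=
    (Real.log_div hP0.ne' hw0.ne').symm
  refine ⟨sub_nonneg.2 (Real.log_le_log hw0 hwP), ?_⟩
  rw [le_div_iff₀ hR, hlog]
  have h1 := Real.log_le_sub_one_of_pos (div_pos hP0 hw0)
  have h2 := Real.one_sub_inv_le_log_of_pos (div_pos hP0 hw0)
  have h3 : w * Real.log (P / w) ≤ P - w := by
    have := mul_le_mul_of_nonneg_left h1 hw0.le
    have e : w * (P / w - 1) = P - w := by field_simp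
    linarith
  have h4 : 1 / w - 1 / P ≤ 1 / w * Real.log (P / w) := by
    have := mul_le_mul_of_nonneg_left h2 (by positivity : 0 ≤ 1 / w)
    have e : 1 / w * (1 - (P / w)⁻¹) = 1 / w - 1 / P := by field_simp
    linarith
  nlinarith

/-- The polynomial relation between the traces `x, y, z` of `X, Y, X Y`, where `X, Y` have
determinants `dx, dy` and the trace of their commutator is `2 - δ²`. -/
def Fricke (δ dx dy x y z : ℝ) : Prop :=
  z ^ 2 - x * y * z + x ^ 2 * dy + y ^ 2 * dx = dx * dy * (4 - δ ^ 2)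

/-- Bound for the failure of additivity of `logRoot` under multiplication of matrices. -/
noncomputable def defect (δ dx dy x y z : ℝ) : ℝ :=
  4 / 3 * δ ^ 2 / (discRoot dx x * discRoot dy y * discRoot (dx * dy) z)

lemma abs_logRoot_sub_le {δ dx dy x y z : ℝ} (hdx : dx = 1 ∨ dx = -1) (hdy : dy = 1 ∨ dy = -1)
    (hx : 0 < x) (hy : 0 < y) (hz : 0 < z) (hx2 : 4 * dx < x ^ 2) (hy2 : 4 * dy < y ^ 2)
    (hz2 : 4 * (dx * dy) < z ^ 2) (hF : Fricke δ dx dy x y z) (hS : 0 < 2 * z - x * y)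
    (hpos : dx * dy = 1 → 16 * δ ^ 2 ≤ 3 * (discRoot dx x * discRoot dy y) ^ 2)
    (hneg : dx * dy = -1 → 6 * δ ^ 2 ≤ discRoot dx x * discRoot dy y *
      (discRoot dx x * discRoot dy y + x * y - 2) ∧ 6 ≤ discRoot dx x * discRoot dy y + x * y) :
    |logRoot (dx * dy) z - logRoot dx x - logRoot dy y| ≤ defect δ dx dy x y z := by
  have hs : dx * dy = 1 ∨ dx * dy = -1 := by
    rcases hdx with rfl | rfl <;> rcases hdy with rfl | rfl <;> norm_num
  unfold Fricke at hF
  unfold defect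
  have hRx := discRoot_sq hx2
  have hRy := discRoot_sq hy2
  have hRx0 := discRoot_pos hx2
  have hRy0 := discRoot_pos hy2
  have hRz0 := discRoot_pos hz2
  obtain ⟨u, hu, hlu, hxu, hru⟩ := exists_root hdx hx hx2
  obtain ⟨v, hv, hlv, hyv, hrv⟩ := exists_root hdy hy hy2
  obtain ⟨w, hw, hlw, hzw, hrw⟩ := exists_root hs hz hz2
  set p := discRoot dx x * discRoot dy y with hp
  have hp0 : 0 < p := mul_pos hRx0 hRy0
  have hu0 : 0 < u := by linarith
  have hv0 : 0 < v := by linarith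
  have hw0 : 0 < w := by linarith
  set P := u * v with hPdef
  have hP : 1 < P := by nlinarith
  have hP0 : 0 < P := by linarith
  have hsum : x * y + p = 2 * (P + dx * dy / P) := by
    rw [hp, hru, hrv, hPdef]
    nth_rewrite 1 [hxu, hyv]
    field_simp; ring
  have hp2 : p ^ 2 = (x ^ 2 - 4 * dx) * (y ^ 2 - 4 * dy) := by
    rw [hp, mul_pow, hRx, hRy]
  have hS2 : (2 * z - x * y) ^ 2 = p ^ 2 - 4 * (dx * dy) * δ ^ 2 := by
    rw [hp2]; linear_combination 4 * hF
  have hlogP : Real.log P = logRoot dx x + logRoot dy y := by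
    rw [hlu, hlv, hPdef, Real.log_mul hu0.ne' hv0.ne']
  rw [sub_sub, ← hlogP, hlw]
  set S := 2 * z - x * y with hSdef
  rcases hs with h1 | h1
  · have hc := hpos h1
    rw [h1] at hsum hS2 hzw hrw ⊢
    have hSp : p / 2 ≤ S := by
      refine (abs_le_of_sq_le_sq' ?_ hS.le).2
      rw [hS2, div_pow]; linarith
    have hSp' : S ≤ p := by
      refine (abs_le_of_sq_le_sq' ?_ hp0.le).2
      rw [hS2]; linarith [sq_nonneg δ]
    have hD : p - S ≤ 8 / 3 * δ ^ 2 / p := by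
      rw [le_div_iff₀ hp0]
      linarith [mul_nonneg (sub_nonneg.2 hSp') (sub_nonneg.2 hSp)]
    have key := log_sub_log_le_of_add_inv (D := 4 / 3 * δ ^ 2 / p) hP hw
      (by have : 8 / 3 * δ ^ 2 / p = 2 * (4 / 3 * δ ^ 2 / p) := by ring
          linarith) (by linarith)
    rw [abs_sub_comm, abs_of_nonneg key.1]
    rw [← div_div, hrw]
    exact key.2
  · obtain ⟨hc, hc6⟩ := hneg h1
    rw [h1] at hsum hS2 hzw hrw ⊢
    have hSp : p ≤ S := by
      refine (abs_le_of_sq_le_sq' ?_ hS.le).2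
      rw [hS2]; linarith [sq_nonneg δ]
    have hD : S - p ≤ 2 * δ ^ 2 / p := by
      rw [le_div_iff₀ hp0]
      linarith [sq_nonneg (S - p)]
    have hD' : z - (P + -1 / P) ≤ δ ^ 2 / p := by
      have : 2 * δ ^ 2 / p = 2 * (δ ^ 2 / p) := by ring
      linarith
    have hPw : P ≤ w := by
      by_contra hlt
      have hlt := not_le.1 hlt
      have : 1 / P ≤ 1 / w := one_div_le_one_div_of_le hw0 hlt.le
      have e1 : -1 / P = - (1 / P) := by ring
      have e2 : -1 / w = - (1 / w) := by ring
      rw [e1] at hsum; rw [e2] at hzw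
      linarith
    have hinv : 1 / w ≤ 1 / P := one_div_le_one_div_of_le hP0 hPw
    have e1 : -1 / P = - (1 / P) := by ring
    have e2 : -1 / w = - (1 / w) := by ring
    rw [e1] at hsum hD'
    rw [e2] at hzw hrw
    have hiP : 0 < 1 / P := by positivity
    have hP3 : 3 ≤ P := by linarith
    have hP3' : 1 / P ≤ 1 / 3 := one_div_le_one_div_of_le (by norm_num) hP3
    have hdp : δ ^ 2 / p ≤ (p + x * y - 2) / 6 := by
      rw [div_le_div_iff₀ hp0 (by norm_num)]; linarith
    have hRz : w - -(1 / w) ≤ 4 / 3 * P := by linarith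
    rw [abs_of_nonneg (sub_nonneg.2 (Real.log_le_log hP0 hPw))]
    rw [← Real.log_div hw0.ne' hP0.ne']
    have hl := Real.log_le_sub_one_of_pos (div_pos hw0 hP0)
    have hwP : w / P - 1 ≤ δ ^ 2 / p / P := by
      rw [div_sub_one hP0.ne', div_le_div_iff_of_pos_right hP0]
      linarith
    refine hl.trans (hwP.trans ?_)
    rw [hrw]
    have hwpos : 0 < w - -(1 / w) := by
      have : 0 < 1 / w := by positivity
      linarith
    rw [div_div, div_le_div_iff₀ (by positivity) (by positivity)]
    have : 0 ≤ δ ^ 2 * p := by positivity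
    linarith [mul_le_mul_of_nonneg_left hRz this]

lemma Fricke.left {δ dx dy x y z : ℝ} (hdx : dx = 1 ∨ dx = -1) (h : Fricke δ dx dy x y z) :
    Fricke δ dx (dx * dy) x z (x * z - dx * y) := by
  unfold Fricke at *
  rcases hdx with rfl | rfl
  · linear_combination h
  · linear_combination -h

lemma Fricke.right {δ dx dy x y z : ℝ} (hdy : dy = 1 ∨ dy = -1) (h : Fricke δ dx dy x y z) :
    Fricke δ (dx * dy) dy z y (z * y - dy * x) := by
  unfold Fricke at *
  rcases hdy with rfl | rfl
  · linear_combination h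
  · linear_combination -h

lemma mul_discRoot_le {c d y w : ℝ} (hy : 4 * d < y ^ 2)
    (h : c ^ 2 * (y ^ 2 - 4 * d) ≤ w ^ 2 - 4 * d) : c * discRoot d y ≤ discRoot d w := by
  apply Real.le_sqrt_of_sq_le
  rw [mul_pow, discRoot_sq hy]
  exact h

lemma le_discRoot {c d y : ℝ} (h : c ^ 2 ≤ y ^ 2 - 4 * d) : c ≤ discRoot d y :=
  Real.le_sqrt_of_sq_le h

lemma defect_pos {δ dx dy x y z : ℝ} (hδ : 0 < δ) (hx : 4 * dx < x ^ 2) (hy : 4 * dy < y ^ 2)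
    (hz : 4 * (dx * dy) < z ^ 2) : 0 < defect δ dx dy x y z := by
  have := discRoot_pos hx
  have := discRoot_pos hy
  have := discRoot_pos hz
  unfold defect
  positivity

lemma mul_defect_left_le {c δ dx dy x y z w : ℝ} (hdx : dx = 1 ∨ dx = -1) (hc : 0 < c)
    (hx : 4 * dx < x ^ 2) (hy : 4 * dy < y ^ 2) (hz : 4 * (dx * dy) < z ^ 2)
    (h : c ^ 2 * (y ^ 2 - 4 * dy) ≤ w ^ 2 - 4 * dy) :
    c * defect δ dx (dx * dy) x z w ≤ defect δ dx dy x y z := by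
  have h1 := discRoot_pos hx
  have h2 := discRoot_pos hy
  have h3 := discRoot_pos hz
  have h4 := mul_discRoot_le hy h
  have e : dx * (dx * dy) = dy := by rcases hdx with rfl | rfl <;> ring
  unfold defect
  rw [e, ← mul_div_assoc]
  have h5 : 0 < discRoot dy w := lt_of_lt_of_le (by positivity) h4
  rw [div_le_div_iff₀ (by positivity) (by positivity)]
  have h6 : 0 ≤ 4 / 3 * δ ^ 2 * (discRoot dx x * discRoot (dx * dy) z) := by positivity
  linarith [mul_le_mul_of_nonneg_left h4 h6]

lemma mul_defect_right_le {c δ dx dy x y z w : ℝ} (hdy : dy = 1 ∨ dy = -1) (hc : 0 < c)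
    (hx : 4 * dx < x ^ 2) (hy : 4 * dy < y ^ 2) (hz : 4 * (dx * dy) < z ^ 2)
    (h : c ^ 2 * (x ^ 2 - 4 * dx) ≤ w ^ 2 - 4 * dx) :
    c * defect δ (dx * dy) dy z y w ≤ defect δ dx dy x y z := by
  have h1 := discRoot_pos hx
  have h2 := discRoot_pos hy
  have h3 := discRoot_pos hz
  have h4 := mul_discRoot_le hx h
  have e : dx * dy * dy = dx := by rcases hdy with rfl | rfl <;> ring
  unfold defect
  rw [e, ← mul_div_assoc]
  have h5 : 0 < discRoot dx w := lt_of_lt_of_le (by positivity) h4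
  rw [div_le_div_iff₀ (by positivity) (by positivity)]
  have h6 : 0 ≤ 4 / 3 * δ ^ 2 * (discRoot dy y * discRoot (dx * dy) z) := by positivity
  linarith [mul_le_mul_of_nonneg_left h4 h6]

/-- Size constraints on the traces `x, y, z` of `X, Y, X Y`, for `X, Y` attached to consecutive
fractions neither of which is `0`. -/
structure Interior (a b dx dy x y z : ℝ) : Prop where
  one_le : 1 ≤ a
  add_one_le : a + 1 ≤ b
  detx : dx = 1 ∨ dx = -1
  dety : dy = 1 ∨ dy = -1
  fricke : Fricke (b - a) dx dy x y z
  le_x : b + 2 ≤ x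
  le_y : b ≤ y
  le_y' : dy = 1 → b + 2 ≤ y
  two_x : 2 * x ≤ z
  two_y : 2 * y + 1 ≤ z
  sum_pos : 0 < 2 * z - x * y

/-- Size constraints on the traces `a, y, z` of `X, Y, X Y`, for `X, Y` attached to the
consecutive fractions `0` and `1/q` with `q ≥ 2`. -/
structure Edge (a b dy y z : ℝ) : Prop where
  one_le : 1 ≤ a
  add_one_le : a + 1 ≤ b
  dety : dy = 1 ∨ dy = -1
  fricke : Fricke (b - a) (-1) dy a y z
  le_y : b + 2 ≤ y
  le_y' : dy = -1 → 2 * b + 2 ≤ y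
  le_z : a * y + b ≤ z

lemma mul_det {dx dy : ℝ} (hx : dx = 1 ∨ dx = -1) (hy : dy = 1 ∨ dy = -1) :
    dx * dy = 1 ∨ dx * dy = -1 := by
  rcases hx with rfl | rfl <;> rcases hy with rfl | rfl <;> norm_num

lemma four_det_lt {d x : ℝ} (hd : d = 1 ∨ d = -1) (hx : 3 ≤ x) : 4 * d < x ^ 2 := by
  rcases hd with rfl | rfl <;> nlinarith

lemma four_mul_neg_one_lt_sq (a : ℝ) : 4 * (-1) < a ^ 2 := by nlinarith

namespace Interior

variable {a b dx dy x y z : ℝ}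

lemma disc_x (h : Interior a b dx dy x y z) : 4 * dx < x ^ 2 :=
  four_det_lt h.detx (by linarith [h.le_x, h.one_le, h.add_one_le])

lemma disc_y (h : Interior a b dx dy x y z) : 4 * dy < y ^ 2 := by
  have := h.one_le
  have := h.add_one_le
  have := h.le_y
  rcases h.dety with hd | hd
  · have := h.le_y' hd
    rw [hd]; nlinarith
  · rw [hd]; nlinarith

lemma disc_z (h : Interior a b dx dy x y z) : 4 * (dx * dy) < z ^ 2 :=
  four_det_lt (mul_det h.detx h.dety) (by linarith [h.le_x, h.one_le, h.add_one_le, h.two_x])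

lemma left (h : Interior a b dx dy x y z) :
    Interior a b dx (dx * dy) x z (x * z - dx * y) := by
  obtain ⟨h1, h2, h3, h4, h5, h6, h7, h8, h9, h10, h11⟩ := h
  refine ⟨h1, h2, h3, mul_det h3 h4, h5.left h3, h6, by linarith, fun _ => by linarith, ?_, ?_, ?_⟩
  all_goals rcases h3 with rfl | rfl <;> nlinarith

lemma right (h : Interior a b dx dy x y z) :
    Interior a b (dx * dy) dy z y (z * y - dy * x) := by
  obtain ⟨h1, h2, h3, h4, h5, h6, h7, h8, h9, h10, h11⟩ := h
  refine ⟨h1, h2, mul_det h3 h4, h4, h5.right h4, by linarith, h7, h8, ?_, ?_, ?_⟩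
  all_goals
    rcases h4 with rfl | rfl
    · have := h8 rfl
      nlinarith
    · nlinarith

lemma defect_left_le (h : Interior a b dx dy x y z) :
    4 * defect (b - a) dx (dx * dy) x z (x * z - dx * y) ≤
    defect (b - a) dx dy x y z := by
  refine mul_defect_left_le h.detx (by norm_num) h.disc_x h.disc_y h.disc_z ?_
  obtain ⟨h1, h2, h3, h4, h5, h6, h7, h8, h9, h10, h11⟩ := h
  have hw : 5 * y + 3 ≤ x * z - dx * y := by rcases h3 with rfl | rfl <;> nlinarith
  have : -1 ≤ dy := by rcases h4 with rfl | rfl <;> norm_num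
  nlinarith

lemma defect_right_le (h : Interior a b dx dy x y z) :
    4 * defect (b - a) (dx * dy) dy z y (z * y - dy * x) ≤
    defect (b - a) dx dy x y z := by
  refine mul_defect_right_le h.dety (by norm_num) h.disc_x h.disc_y h.disc_z ?_
  obtain ⟨h1, h2, h3, h4, h5, h6, h7, h8, h9, h10, h11⟩ := h
  have hw : 5 * x ≤ z * y - dy * x := by
    rcases h4 with rfl | rfl
    · have := h8 rfl
      nlinarith
    · nlinarith
  have : -1 ≤ dx := by rcases h3 with rfl | rfl <;> norm_num
  nlinarith

lemma abs_logRoot_sub_le (h : Interior a b dx dy x y z) :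
    |logRoot (dx * dy) z - logRoot dx x - logRoot dy y| ≤
    defect (b - a) dx dy x y z := by
  have hx := h.disc_x
  have hy := h.disc_y
  have hz := h.disc_z
  obtain ⟨h1, h2, h3, h4, h5, h6, h7, h8, h9, h10, h11⟩ := h
  have r1 : b + 1 ≤ discRoot dx x :=
    le_discRoot (by rcases h3 with rfl | rfl <;> nlinarith)
  have r2 : b ≤ discRoot dy y := by
    apply le_discRoot
    rcases h4 with rfl | rfl
    · have := h8 rfl
      nlinarith
    · nlinarith
  have r3 : 3 * b ≤ discRoot dx x * discRoot dy y := by nlinarith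
  have r4 : 8 ≤ x * y := by nlinarith
  have r5 : (b - a) ^ 2 ≤ b ^ 2 := by nlinarith
  have r6 : (3 * b) ^ 2 ≤ (discRoot dx x * discRoot dy y) ^ 2 :=
    pow_le_pow_left₀ (by linarith) r3 2
  exact _root_.abs_logRoot_sub_le h3 h4 (by linarith) (by linarith) (by linarith) hx hy hz h5 h11
    (fun _ => by nlinarith) (fun _ => ⟨by nlinarith, by linarith⟩)

end Interior

namespace Edge

variable {a b dy y z : ℝ}

lemma disc_y (h : Edge a b dy y z) : 4 * dy < y ^ 2 :=
  four_det_lt h.dety (by linarith [h.le_y, h.one_le, h.add_one_le])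

lemma le_z' (h : Edge a b dy y z) : 2 * b + 2 ≤ z := by
  have := h.le_y
  have := h.one_le
  have := h.add_one_le
  have := h.le_z
  nlinarith

lemma disc_z (h : Edge a b dy y z) : 4 * (-1 * dy) < z ^ 2 :=
  four_det_lt (mul_det (Or.inr rfl) h.dety) (by linarith [h.le_z', h.one_le, h.add_one_le])

lemma left (h : Edge a b dy y z) : Edge a b (-1 * dy) z (a * z - -1 * y) := by
  have h0 := h.le_z'
  obtain ⟨h1, h2, h3, h4, h5, h6, h7⟩ := h
  exact ⟨h1, h2, mul_det (Or.inr rfl) h3, h4.left (Or.inr rfl), by linarith, fun _ => h0,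
    by linarith⟩

lemma right (h : Edge a b dy y z) :
    Interior a b (-1 * dy) dy z y (z * y - dy * a) := by
  have h0 := h.le_z'
  obtain ⟨h1, h2, h3, h4, h5, h6, h7⟩ := h
  have hy : y ≤ z := by nlinarith
  refine ⟨h1, h2, mul_det (Or.inr rfl) h3, h3, h4.right h3, by linarith, by linarith,
    fun _ => h5, ?_, ?_, ?_⟩
  all_goals rcases h3 with rfl | rfl <;> nlinarith

lemma defect_left_le (h : Edge a b dy y z) :
    2 * defect (b - a) (-1) (-1 * dy) a z (a * z - -1 * y) ≤
    defect (b - a) (-1) dy a y z := by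
  refine mul_defect_left_le (Or.inr rfl) (by norm_num) (four_mul_neg_one_lt_sq a) h.disc_y
    h.disc_z ?_
  obtain ⟨h1, h2, h3, h4, h5, h6, h7⟩ := h
  have hz : y + 2 ≤ z := by nlinarith
  have hw : 2 * y + 2 ≤ a * z - -1 * y := by nlinarith
  have : -1 ≤ dy := by rcases h3 with rfl | rfl <;> norm_num
  nlinarith

lemma defect_right_le (h : Edge a b dy y z) :
    4 * defect (b - a) (-1 * dy) dy z y (z * y - dy * a) ≤
    defect (b - a) (-1) dy a y z := by
  refine mul_defect_right_le h.dety (by norm_num) (four_mul_neg_one_lt_sq a) h.disc_y h.disc_z ?_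
  obtain ⟨h1, h2, h3, h4, h5, h6, h7⟩ := h
  have hz : 5 * a + 1 ≤ z := by nlinarith
  have hw : 4 * a + 8 ≤ z * y - dy * a := by rcases h3 with rfl | rfl <;> nlinarith
  nlinarith

lemma abs_logRoot_sub_le (h : Edge a b dy y z) :
    |logRoot (-1 * dy) z - logRoot (-1) a - logRoot dy y| ≤
    defect (b - a) (-1) dy a y z := by
  have hx := (four_mul_neg_one_lt_sq a)
  have hy := h.disc_y
  have hz := h.disc_z
  have h0 := h.le_z'
  obtain ⟨h1, h2, h3, h4, h5, h6, h7⟩ := h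
  have r1 : 2 ≤ discRoot (-1) a := le_discRoot (by nlinarith)
  have r2 : b + 1 ≤ discRoot dy y :=
    le_discRoot (by rcases h3 with rfl | rfl <;> nlinarith)
  have r3 : 2 * (b + 1) ≤ discRoot (-1) a * discRoot dy y := by nlinarith
  have r4 : b + 2 ≤ a * y := by nlinarith
  have r5 : (b - a) ^ 2 ≤ b ^ 2 := by nlinarith
  refine _root_.abs_logRoot_sub_le (Or.inr rfl) h3 (by linarith) (by linarith) (by linarith)
    hx hy hz h4 (by nlinarith) (fun hd => ?_) (fun _ => ⟨?_, by linarith⟩)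
  · have hd' : dy = -1 := by linarith
    have h8 := h6 hd'
    have r6 : 2 * b + 2 ≤ discRoot dy y := le_discRoot (by rw [hd']; nlinarith)
    have r7 : 4 * b ≤ discRoot (-1) a * discRoot dy y := by nlinarith
    have r8 : (4 * b) ^ 2 ≤ (discRoot (-1) a * discRoot dy y) ^ 2 :=
      pow_le_pow_left₀ (by linarith) r7 2
    nlinarith
  · nlinarith

end Edge

lemma logRoot_lt_logRoot {a b : ℝ} (ha : 1 ≤ a) (hab : a + 1 ≤ b) :
    logRoot (-1) a < logRoot (-1) b := by
  have h1 : discRoot (-1) a ≤ discRoot (-1) b := Real.sqrt_le_sqrt (by nlinarith)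
  have h2 : 0 < discRoot (-1) a := discRoot_pos (by nlinarith)
  exact Real.log_lt_log (by linarith) (by linarith)

lemma div_le_log_of_add_le {s t u : ℝ} (hs : 0 < s) (hu : 0 ≤ u) (h : s + u ≤ t) :
    2 * u / (2 * s + u) ≤ Real.log t - Real.log s := by
  have h1 := Real.le_log_one_add_of_nonneg (div_nonneg hu hs.le)
  have h2 : 2 * (u / s) / (u / s + 2) = 2 * u / (2 * s + u) := by
    field_simp; ring
  have h3 : Real.log (1 + u / s) = Real.log (s + u) - Real.log s := by
    rw [← Real.log_div (by positivity) hs.ne']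
    congr 1; field_simp
  have h4 := Real.log_le_log (by positivity) h
  linarith

lemma add_sub_le_of_add_inv {s t m n : ℝ} (hs : 1 < s) (ht : 1 < t) (hm : s + 1 / s = m)
    (hn : t + 1 / t = n) (h : m ≤ n) : s + (n - m) ≤ t := by
  have hs0 : 0 < s := by linarith
  have ht0 : 0 < t := by linarith
  have hst : s ≤ t := by
    by_contra hc
    have hc := not_le.1 hc
    have hfac : t + 1 / t - (s + 1 / s) = (t - s) * (1 - 1 / (s * t)) := by
      field_simp; ring
    have : 1 / (s * t) < 1 := by
      rw [div_lt_one (by positivity)]; nlinarith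
    nlinarith
  have := one_div_le_one_div_of_le hs0 hst
  linarith

lemma sq_add_inv {u x : ℝ} (hu : 1 < u) (h : x = u + -1 / u) :
    u ^ 2 + 1 / u ^ 2 = x ^ 2 + 2 := by
  have : u ≠ 0 := by linarith
  rw [h]; field_simp; ring

lemma edge_base {a b : ℝ} (ha : 1 ≤ a) (hab : a + 1 ≤ b) :
    Edge a b 1 (a * b + 2) (a * (a * b + 2) + b) := by
  refine ⟨ha, hab, Or.inl rfl, ?_, by nlinarith, fun h => by norm_num at h, le_rfl⟩
  unfold Fricke; ring

lemma interior_base {a b : ℝ} (ha : 1 ≤ a) (hab : a + 1 ≤ b) :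
    Interior a b 1 (-1) (a * b + 2) b ((a * b + 2) * b + a) := by
  have h1 : b ≤ a * b := by nlinarith
  have h2 : 0 ≤ (a * b + 2) * (b - 2) := mul_nonneg (by linarith) (by linarith)
  refine ⟨ha, hab, Or.inl rfl, Or.inr rfl, ?_, by linarith, le_rfl, fun h => by norm_num at h,
    by linarith, by linarith, by linarith⟩
  unfold Fricke; ring

lemma defect_edge_base_le {a b : ℝ} (ha : 1 ≤ a) (hab : a + 1 ≤ b) :
    6 * defect (b - a) (-1) 1 a (a * b + 2) (a * (a * b + 2) + b) ≤
      logRoot 1 (a * b + 2) - 2 * logRoot (-1) a := by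
  have h := edge_base ha hab
  obtain ⟨u, hu, hlu, hau, hru⟩ := exists_root (Or.inr rfl) (by linarith) (four_mul_neg_one_lt_sq a)
  obtain ⟨w, hw, hlw, hzw, -⟩ := exists_root (Or.inl rfl) (by nlinarith) h.disc_y
  have hu2 : 1 < u ^ 2 := one_lt_pow₀ hu (by norm_num)
  have hgap := add_sub_le_of_add_inv hu2 hw (sq_add_inv hu hau) hzw.symm (by nlinarith)
  obtain ⟨d, rfl⟩ : ∃ d, b = a + d := ⟨b - a, by ring⟩
  have hd : 1 ≤ d := by linarith
  have hlog := div_le_log_of_add_le (u := a * d) (by positivity) (by positivity)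
    (by linarith : u ^ 2 + a * d ≤ w)
  rw [hlu, hlw, show 2 * Real.log u = Real.log (u ^ 2) by simp]
  refine le_trans ?_ hlog
  have hrs : discRoot (-1) a ^ 2 = a ^ 2 + 4 := by
    rw [discRoot_sq (four_mul_neg_one_lt_sq a)]; ring
  have hr : 11 / 5 ≤ discRoot (-1) a := le_discRoot (by nlinarith)
  have hu3 : 2 * u ^ 2 = a ^ 2 + a * discRoot (-1) a + 2 := by
    have hu0 : u ≠ 0 := by linarith
    have e : a * u = u ^ 2 - 1 := by rw [hau]; field_simp; ring
    have e2 : a + discRoot (-1) a = 2 * u := by rw [hru]; nth_rewrite 1 [hau]; ring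
    linear_combination (-a) * e2 - 2 * e
  have h1 : a * (a + d) + 1 ≤ discRoot 1 (a * (a + d) + 2) := le_discRoot (by nlinarith)
  have h2 : a * (a * (a + d) + 2) + (a + d) ≤
      discRoot (-1 * 1) (a * (a * (a + d) + 2) + (a + d)) := le_discRoot (by linarith)
  unfold defect
  set r := discRoot (-1) a
  set r1 := discRoot 1 (a * (a + d) + 2)
  set r2 := discRoot (-1 * 1) (a * (a * (a + d) + 2) + (a + d))
  have h3 : (a * (a + d) + 1) * (a * (a * (a + d) + 2) + (a + d)) ≤ r1 * r2 :=
    mul_le_mul h1 h2 (by positivity) (le_trans (by positivity) h1)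
  have hr0 : 0 < r := by linarith
  have hr1 : 0 < r1 := lt_of_lt_of_le (by positivity) h1
  have hr2 : 0 < r2 := lt_of_lt_of_le (by positivity) h2
  rw [show a + d - a = d by ring, ← mul_div_assoc, div_le_div_iff₀ (by positivity) (by positivity),
    hu3]
  have key : 4 * d * (a ^ 2 + a * r + 2 + a * d) ≤
      a * r * ((a * (a + d) + 1) * (a * (a * (a + d) + 2) + (a + d))) := by
    have k0 : a ^ 2 * (2 * (2 + d) ^ 2) ≤
        (a * (a + d) + 1) * (a * (a * (a + d) + 2) + (a + d)) := by
      have e1 : a * (2 + d) ≤ a * (a + d) + 1 := by linarith [sq_nonneg (a - 1)]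
      have e2 : a * (2 * (2 + d)) ≤ a * (a * (a + d) + 2) + (a + d) := by
        have : 0 ≤ a * ((a - 1) * (a + 1)) :=
          mul_nonneg (by linarith) (mul_nonneg (by linarith) (by linarith))
        linarith [mul_nonneg (by linarith : 0 ≤ d) (sq_nonneg (a - 1))]
      linarith [mul_le_mul e1 e2 (by positivity) (by positivity)]
    have ha2 : a ≤ a ^ 2 := by nlinarith
    have k1 : 0 ≤ (a * (a + d) + 1) * (a * (a * (a + d) + 2) + (a + d)) - 4 * d := by
      have : 2 * (2 + d) ^ 2 ≤ a ^ 2 * (2 * (2 + d) ^ 2) :=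
        le_mul_of_one_le_left (by positivity) (by linarith)
      nlinarith [sq_nonneg d]
    have k2 := mul_le_mul_of_nonneg_right hr (mul_nonneg (by linarith : 0 ≤ a) k1)
    have k3 : a ^ 2 * (2 * (2 + d) ^ 2 - 4 * d) ≤
        a * ((a * (a + d) + 1) * (a * (a * (a + d) + 2) + (a + d)) - 4 * d) := by
      have e1 := mul_le_mul_of_nonneg_left k0 (by linarith : 0 ≤ a)
      have e2 := mul_le_mul_of_nonneg_right ha2 (by positivity : 0 ≤ a * (2 * (2 + d) ^ 2))
      have e3 := mul_le_mul_of_nonneg_right ha2 (by positivity : 0 ≤ 4 * d)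
      linarith
    have k4 : a ^ 2 * (4 * d * (3 + d)) ≤ a ^ 2 * (11 / 5 * (2 * (2 + d) ^ 2 - 4 * d)) :=
      mul_le_mul_of_nonneg_left (by nlinarith [sq_nonneg (d - 4)]) (by positivity)
    have k5 : 4 * d * (a ^ 2 + 2 + a * d) ≤ a ^ 2 * (4 * d * (3 + d)) := by
      have e1 := mul_le_mul_of_nonneg_right ha2 (by positivity : 0 ≤ 4 * d * d)
      have e2 := mul_le_mul_of_nonneg_right (ha.trans ha2) (by positivity : 0 ≤ 8 * d)
      linarith
    linarith
  have := mul_le_mul_of_nonneg_left h3 (by positivity : 0 ≤ a * r)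
  have := mul_le_mul_of_nonneg_left (key.trans this) (by positivity : 0 ≤ 2 * d)
  linarith

lemma defect_interior_base_le {a b : ℝ} (ha : 1 ≤ a) (hab : a + 1 ≤ b) :
    6 * defect (b - a) 1 (-1) (a * b + 2) b ((a * b + 2) * b + a) ≤
      2 * logRoot (-1) b - logRoot 1 (a * b + 2) := by
  have h := interior_base ha hab
  obtain ⟨v, hv, hlv, hbv, -⟩ := exists_root (Or.inr rfl) (by linarith) h.disc_y
  obtain ⟨w, hw, hlw, hzw, -⟩ := exists_root (Or.inl rfl) (by nlinarith) h.disc_x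
  have hv2 : 1 < v ^ 2 := one_lt_pow₀ hv (by norm_num)
  have hgap := add_sub_le_of_add_inv hw hv2 hzw.symm (sq_add_inv hv hbv) (by nlinarith)
  obtain ⟨d, rfl⟩ : ∃ d, b = a + d := ⟨b - a, by ring⟩
  have hd : 1 ≤ d := by linarith
  have hlog := div_le_log_of_add_le (u := (a + d) * d) (by positivity) (by positivity)
    (by linarith : w + (a + d) * d ≤ v ^ 2)
  rw [hlv, hlw, show 2 * Real.log v = Real.log (v ^ 2) by simp]
  refine le_trans ?_ hlog
  have hw2 : w ≤ a * (a + d) + 2 := by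
    have : 0 < 1 / w := by positivity
    linarith
  have h0 : a + d ≤ discRoot (-1) (a + d) := le_discRoot (by nlinarith)
  have h1 : a * (a + d) + 1 ≤ discRoot 1 (a * (a + d) + 2) := le_discRoot (by nlinarith)
  have h2 : (a * (a + d) + 2) * (a + d) + a ≤
      discRoot (1 * -1) ((a * (a + d) + 2) * (a + d) + a) := le_discRoot (by linarith)
  unfold defect
  set r := discRoot (-1) (a + d)
  set r1 := discRoot 1 (a * (a + d) + 2)
  set r2 := discRoot (1 * -1) ((a * (a + d) + 2) * (a + d) + a)
  have h3 : (a * (a + d) + 1) * (a + d) * ((a * (a + d) + 2) * (a + d) + a) ≤ r1 * r * r2 :=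
    mul_le_mul (mul_le_mul h1 h0 (by positivity) (le_trans (by positivity) h1)) h2 (by positivity)
      (mul_nonneg (le_trans (by positivity) h1) (le_trans (by positivity) h0))
  have hr0 : 0 < r := lt_of_lt_of_le (by positivity) h0
  have hr1 : 0 < r1 := lt_of_lt_of_le (by positivity) h1
  have hr2 : 0 < r2 := lt_of_lt_of_le (by positivity) h2
  rw [show a + d - a = d by ring, ← mul_div_assoc, div_le_div_iff₀ (by positivity) (by positivity)]
  have key : 4 * d * (2 * (a * (a + d) + 2) + (a + d) * d) ≤
      (a + d) * ((a * (a + d) + 1) * (a + d) * ((a * (a + d) + 2) * (a + d) + a)) := by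
    have hb : 2 ≤ a + d := by linarith
    have hdb : d ≤ a + d := by linarith
    generalize a + d = b at *
    have e1 : 4 * d * (2 * (a * b + 2) + b * d) ≤ 4 * b * (2 * (a * b + b) + b * b) := by
      gcongr
    have e2 : 4 * (2 * a + 2 + b) ≤ b * ((a * b + 1) * (a * b + 2)) := by
      have e3 : 2 * ((a * b + 1) * (a * b + 2)) ≤ b * ((a * b + 1) * (a * b + 2)) := by gcongr
      have e4 : b ≤ a * b := by nlinarith
      have e5 : 2 * a ≤ a * b := by nlinarith
      nlinarith
    have e6 := mul_le_mul_of_nonneg_left e2 (by positivity : 0 ≤ b ^ 2)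
    have e7 : 0 ≤ b * ((a * b + 1) * b * a) := by positivity
    linarith
  have e1 := mul_le_mul_of_nonneg_left h3 (by positivity : 0 ≤ a + d)
  have e2 := mul_le_mul_of_nonneg_left (key.trans e1) (by positivity : 0 ≤ 2 * d)
  have e3 := mul_le_mul_of_nonneg_left hw2 (by positivity : 0 ≤ 8 * d ^ 2 * 2)
  linarith

/-- `SternBrocot p q p' q'`: the fractions `p/q < p'/q'` are the endpoints of an interval of the
Stern–Brocot subdivision of `[0, 1]`. -/
inductive SternBrocot : ℕ → ℕ → ℕ → ℕ → Prop
  | root : SternBrocot 0 1 1 1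
  | left {p q p' q' : ℕ} : SternBrocot p q p' q' → SternBrocot p q (p + p') (q + q')
  | right {p q p' q' : ℕ} : SternBrocot p q p' q' → SternBrocot (p + p') (q + q') p' q'

namespace SternBrocot

lemma det_eq {p q p' q' : ℕ} (h : SternBrocot p q p' q') : p' * q = p * q' + 1 := by
  induction h with
  | root => rfl
  | left _ ih => linarith
  | right _ ih => linarith

lemma pos_left {p q p' q' : ℕ} (h : SternBrocot p q p' q') : 0 < q := by
  induction h with
  | root => exact one_pos
  | left _ ih => exact ih
  | right _ ih => omega

lemma pos_right {p q p' q' : ℕ} (h : SternBrocot p q p' q') : 0 < q' := by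
  induction h with
  | root => exact one_pos
  | left _ ih => omega
  | right _ ih => exact ih

end SternBrocot

/-- The inductive hypothesis for the monotonicity of `log ρ(X_{p/q}) / q` along the Stern–Brocot
tree, where `t p q` is the trace of `X_{p/q}`. -/
structure GrowthGap (a b : ℝ) (t : ℕ → ℕ → ℝ) (p q p' q' : ℕ) : Prop where
  size : (q = 1 ∧ 1 ≤ q' ∧ t p q = a ∧ Edge a b ((-1) ^ q') (t p' q') (t (p + p') (q + q'))) ∨
    Interior a b ((-1) ^ q) ((-1) ^ q') (t p q) (t p' q') (t (p + p') (q + q'))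
  gap : 2 * ((q : ℝ) + q') *
      defect (b - a) ((-1) ^ q) ((-1) ^ q') (t p q) (t p' q') (t (p + p') (q + q')) ≤
    q * logRoot ((-1) ^ q') (t p' q') - q' * logRoot ((-1) ^ q) (t p q)

namespace GrowthGap

variable {a b : ℝ} {t : ℕ → ℕ → ℝ} {p q p' q' : ℕ}

lemma pos (h : GrowthGap a b t p q p' q') (hq : 0 < q) :
    0 < q * logRoot ((-1) ^ q') (t p' q') - q' * logRoot ((-1) ^ q) (t p q) := by
  refine lt_of_lt_of_le (mul_pos (by positivity) ?_) h.gap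
  rcases h.size with ⟨hq, -, ht, hE⟩ | hI
  · subst hq
    rw [ht, pow_one]
    exact defect_pos (by linarith [hE.add_one_le]) (four_mul_neg_one_lt_sq a) hE.disc_y hE.disc_z
  · exact defect_pos (by linarith [hI.add_one_le]) hI.disc_x hI.disc_y hI.disc_z

lemma left (h : GrowthGap a b t p q p' q')
    (ht : t (p + (p + p')) (q + (q + q')) =
      t p q * t (p + p') (q + q') - (-1) ^ q * t p' q') :
    GrowthGap a b t p q (p + p') (q + q') := by
  obtain ⟨hs, hg⟩ := h
  rcases hs with ⟨rfl, hq', hta, hE⟩ | hI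
  · rw [hta, pow_one] at ht hg
    have hE' := hE.left
    have hd := hE.defect_left_le
    have hl := abs_le.1 hE.abs_logRoot_sub_le
    have hpos := defect_pos (δ := b - a) (by linarith [hE.add_one_le])
      (four_mul_neg_one_lt_sq a) hE'.disc_y hE'.disc_z
    refine ⟨Or.inl ⟨rfl, by omega, hta, ?_⟩, ?_⟩
    · rw [ht, pow_add, pow_one]; exact hE'
    · rw [hta, ht, pow_add, pow_one]
      push_cast at hg ⊢
      have hq1 : (1 : ℝ) ≤ q' := by exact_mod_cast hq'
      nlinarith
  · have hI' := hI.left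
    have hd := hI.defect_left_le
    have hl := abs_le.1 hI.abs_logRoot_sub_le
    have hpos := defect_pos (δ := b - a) (by linarith [hI.add_one_le])
      hI'.disc_x hI'.disc_y hI'.disc_z
    refine ⟨Or.inr ?_, ?_⟩
    · rw [ht, pow_add]; exact hI'
    · rw [ht, pow_add]
      push_cast
      have hq0 : (0 : ℝ) ≤ q := Nat.cast_nonneg q
      have hq1 : (0 : ℝ) ≤ q' := Nat.cast_nonneg q'
      have e1 := mul_le_mul_of_nonneg_left hl.1 hq0
      have e2 := mul_le_mul_of_nonneg_left hd hq0
      have e3 := mul_le_mul_of_nonneg_left hd hq1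
      have e4 := mul_nonneg hq0 hpos.le
      have e5 := mul_nonneg hq1 hpos.le
      linarith

lemma right (h : GrowthGap a b t p q p' q')
    (ht : t (p + p' + p') (q + q' + q') =
      t (p + p') (q + q') * t p' q' - (-1) ^ q' * t p q) :
    GrowthGap a b t (p + p') (q + q') p' q' := by
  have key : ∀ {dx dy x y z v lx ly lz : ℝ}, 4 * defect (b - a) (dx * dy) dy z y v ≤
      defect (b - a) dx dy x y z → 0 ≤ defect (b - a) (dx * dy) dy z y v →
      |lz - lx - ly| ≤ defect (b - a) dx dy x y z →
      2 * ((q : ℝ) + q') * defect (b - a) dx dy x y z ≤ q * ly - q' * lx →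
      2 * ((q : ℝ) + q' + q') * defect (b - a) (dx * dy) dy z y v ≤ (q + q') * ly - q' * lz := by
    intro dx dy x y z v lx ly lz hd hpos hl hg
    have hq0 : (0 : ℝ) ≤ q := Nat.cast_nonneg q
    have hq1 : (0 : ℝ) ≤ q' := Nat.cast_nonneg q'
    have e1 := mul_le_mul_of_nonneg_left (abs_le.1 hl).2 hq1
    have e2 := mul_le_mul_of_nonneg_left hd hq0
    have e3 := mul_le_mul_of_nonneg_left hd hq1
    have e4 := mul_nonneg hq0 hpos
    have e5 := mul_nonneg hq1 hpos
    linarith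
  obtain ⟨hs, hg⟩ := h
  rcases hs with ⟨rfl, hq', hta, hE⟩ | hI
  · rw [hta] at ht hg
    rw [pow_one] at hg
    have hI' := hE.right
    refine ⟨Or.inr ?_, ?_⟩
    · rw [ht, pow_add, pow_one]; exact hI'
    · rw [ht, pow_add, pow_one]
      have := key hE.defect_right_le (defect_pos (by linarith [hE.add_one_le])
        hI'.disc_x hI'.disc_y hI'.disc_z).le hE.abs_logRoot_sub_le hg
      exact_mod_cast this
  · have hI' := hI.right
    refine ⟨Or.inr ?_, ?_⟩
    · rw [ht, pow_add]; exact hI'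
    · rw [ht, pow_add]
      have := key hI.defect_right_le (defect_pos (by linarith [hI.add_one_le])
        hI'.disc_x hI'.disc_y hI'.disc_z).le hI.abs_logRoot_sub_le hg
      exact_mod_cast this

end GrowthGap

/-- The trace identities satisfied by matrices `X_{p/q}` with `X_{0/1}`, `X_{1/1}` equal to
`cfMat a`, `cfMat b` and `X_{(p + p')/(q + q')} = X_{p/q} X_{p'/q'}`. -/
structure IsTraceTree (a b : ℝ) (t : ℕ → ℕ → ℝ) : Prop where
  zero_one : t 0 1 = a
  one_one : t 1 1 = b
  one_two : t 1 2 = a * b + 2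
  left : ∀ {p q p' q' : ℕ}, SternBrocot p q p' q' → t (p + (p + p')) (q + (q + q')) =
      t p q * t (p + p') (q + q') - (-1) ^ q * t p' q'
  right : ∀ {p q p' q' : ℕ}, SternBrocot p q p' q' → t (p + p' + p') (q + q' + q') =
      t (p + p') (q + q') * t p' q' - (-1) ^ q' * t p q

lemma SternBrocot.growthGap {a b : ℝ} (ha : 1 ≤ a) (hab : a + 1 ≤ b) {t : ℕ → ℕ → ℝ}
    (ht : IsTraceTree a b t) {p q p' q' : ℕ} (h : SternBrocot p q p' q') :
    (p = 0 ∧ q = 1 ∧ p' = 1 ∧ q' = 1) ∨ GrowthGap a b t p q p' q' := by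
  have h01 := ht.zero_one
  have h11 := ht.one_one
  have h12 := ht.one_two
  induction h with
  | root => exact Or.inl ⟨rfl, rfl, rfl, rfl⟩
  | @left p q p' q' h ih =>
    right
    rcases ih with ⟨rfl, rfl, rfl, rfl⟩ | ih
    · have h13 : t 1 3 = a * (a * b + 2) + b := by
        have := ht.left SternBrocot.root
        norm_num [h01, h11, h12] at this
        exact this
      have h1 := edge_base ha hab
      have h2 := defect_edge_base_le ha hab
      refine ⟨Or.inl ⟨rfl, by norm_num, h01, ?_⟩, ?_⟩
      · norm_num [h01, h12, h13]
        exact h1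
      · norm_num [h01, h12, h13]
        exact h2
    · exact ih.left (ht.left h)
  | @right p q p' q' h ih =>
    right
    rcases ih with ⟨rfl, rfl, rfl, rfl⟩ | ih
    · have h23 : t 2 3 = (a * b + 2) * b + a := by
        have := ht.right SternBrocot.root
        norm_num [h01, h11, h12] at this
        exact this
      have h1 := interior_base ha hab
      have h2 := defect_interior_base_le ha hab
      refine ⟨Or.inr ?_, ?_⟩
      · norm_num [h11, h12, h23]
        exact h1
      · norm_num [h11, h12, h23]
        exact h2
    · exact ih.right (ht.right h)

lemma SternBrocot.logRoot_div_lt {a b : ℝ} (ha : 1 ≤ a) (hab : a + 1 ≤ b) {t : ℕ → ℕ → ℝ}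
    (ht : IsTraceTree a b t) {p q p' q' : ℕ} (h : SternBrocot p q p' q') :
    logRoot ((-1) ^ q) (t p q) / q < logRoot ((-1) ^ q') (t p' q') / q' := by
  have hq := h.pos_left
  have hq' := h.pos_right
  rw [div_lt_div_iff₀ (by exact_mod_cast hq) (by exact_mod_cast hq')]
  rcases h.growthGap ha hab ht with ⟨rfl, rfl, rfl, rfl⟩ | hG
  · simpa [ht.zero_one, ht.one_one] using logRoot_lt_logRoot ha hab
  · linarith [hG.pos hq]

/-- A function of `p/q` which increases along every Stern–Brocot interval is strictly
increasing. -/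
lemma SternBrocot.lt_of_lt {f : ℕ → ℕ → ℝ}
    (hf : ∀ {p q p' q' : ℕ}, SternBrocot p q p' q' → f p q < f p' q') (N : ℕ) (k : ℕ) :
    ∀ {p q p' q' : ℕ}, SternBrocot p q p' q' → N < q + q' + k →
    ∀ {m n m' n' : ℕ}, 0 < n → 0 < n' → n ≤ N → n' ≤ N → m.Coprime n → m'.Coprime n' →
    p * n ≤ m * q → m' * q' ≤ p' * n' → m * n' < m' * n → f m n < f m' n' := by
  have eq_of {a b c d : ℕ} (h1 : a.Coprime b) (h2 : c.Coprime d) (hb : 0 < b)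
      (h : a * d = c * b) : a = c ∧ b = d := by
    have e1 : a ∣ c := h1.dvd_of_dvd_mul_right (h ▸ dvd_mul_right a d)
    have e2 : c ∣ a := h2.dvd_of_dvd_mul_right (h ▸ dvd_mul_right c b)
    have e := Nat.dvd_antisymm e1 e2
    refine ⟨e, Nat.dvd_antisymm (h1.symm.dvd_of_dvd_mul_left ?_)
      (h2.symm.dvd_of_dvd_mul_left ?_)⟩
    · exact ⟨c, by linarith⟩
    · exact ⟨a, by linarith⟩
  -- A fraction strictly inside the interval has a large denominator.
  have large {p q p' q' m n : ℕ} (h : SternBrocot p q p' q') (h1 : p * n < m * q)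
      (h2 : m * q' < p' * n) : q + q' ≤ n := by
    have hd := h.det_eq
    have e1 : q * (m * q' + 1) ≤ q * (p' * n) := Nat.mul_le_mul_left _ h2
    have e2 : q' * (p * n + 1) ≤ q' * (m * q) := Nat.mul_le_mul_left _ h1
    have e3 : p' * q * n = (p * q' + 1) * n := by rw [hd]
    nlinarith
  have coprime {p q p' q' : ℕ} (h : SternBrocot p q p' q') : p.Coprime q ∧ p'.Coprime q' := by
    have hd : (p' : ℤ) * q = p * q' + 1 := by exact_mod_cast h.det_eq
    exact ⟨Nat.isCoprime_iff_coprime.1 ⟨-q', p', by linarith⟩,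
      Nat.isCoprime_iff_coprime.1 ⟨q, -p, by linarith⟩⟩
  have small {p q p' q' m n m' n' : ℕ} (h : SternBrocot p q p' q') (hN : N < q + q')
      (hn : 0 < n) (hn' : 0 < n') (hnN : n ≤ N) (hnN' : n' ≤ N) (hc : m.Coprime n)
      (hc' : m'.Coprime n') (h1 : p * n ≤ m * q) (h2 : m' * q' ≤ p' * n')
      (h3 : m * n' < m' * n) : f m n < f m' n' := by
    have l1 : p * n = m * q := by
      refine h1.antisymm (not_lt.1 fun hlt => ?_)
      have : m * q' < p' * n := by
        refine Nat.lt_of_mul_lt_mul_left (a := n') ?_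
        have := Nat.mul_lt_mul_of_pos_right h3 h.pos_right
        have := Nat.mul_le_mul_right n h2
        linarith
      exact absurd (large h hlt this) (by omega)
    have l2 : m' * q' = p' * n' := by
      refine h2.antisymm (not_lt.1 fun hlt => ?_)
      have : p * n' < m' * q := by
        refine Nat.lt_of_mul_lt_mul_left (a := n) ?_
        have := Nat.mul_lt_mul_of_pos_right h3 h.pos_left
        have := Nat.mul_le_mul_right n' h1
        linarith
      exact absurd (large h this hlt) (by omega)
    obtain ⟨rfl, rfl⟩ := eq_of (coprime h).1 hc h.pos_left l1
    obtain ⟨rfl, rfl⟩ := eq_of hc' (coprime h).2 hn' l2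
    exact hf h
  induction k with
  | zero =>
    intro p q p' q' h hN m n m' n' hn hn' hnN hnN' hc hc' h1 h2 h3
    exact small h hN hn hn' hnN hnN' hc hc' h1 h2 h3
  | succ k ih =>
    intro p q p' q' h hN m n m' n' hn hn' hnN hnN' hc hc' h1 h2 h3
    have hq := h.pos_left
    have hq' := h.pos_right
    rcases le_or_gt (m' * (q + q')) ((p + p') * n') with hr | hr
    · exact ih h.left (by omega) hn hn' hnN hnN' hc hc' h1 hr h3
    rcases le_or_gt ((p + p') * n) (m * (q + q')) with hl | hl
    · exact ih h.right (by omega) hn hn' hnN hnN' hc hc' hl h2 h3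
    rcases lt_or_ge N (q + q') with hs | hs
    · exact small h hs hn hn' hnN hnN' hc hc' h1 h2 h3
    have hM := (coprime h.left).2
    exact (ih h.left (by omega) hn (by omega) hnN hs hc hM h1 le_rfl hl).trans
      (ih h.right (by omega) (by omega) hn' hs hnN' hM hc' le_rfl h2 hr)

/-- The product `cfMat (w 1) ⋯ cfMat (w n)`. -/
noncomputable def prodMat (w : ℕ → ℕ) : ℕ → Matrix (Fin 2) (Fin 2) ℝ
  | 0 => 1
  | n + 1 => prodMat w n * cfMat (w (n + 1))

lemma prodMat_succ_apply (w : ℕ → ℕ) (n : ℕ) :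
    prodMat w (n + 1) 0 0 = prodMat w n 0 0 * w (n + 1) + prodMat w n 0 1 ∧
    prodMat w (n + 1) 0 1 = prodMat w n 0 0 ∧
    prodMat w (n + 1) 1 0 = prodMat w n 1 0 * w (n + 1) + prodMat w n 1 1 ∧
    prodMat w (n + 1) 1 1 = prodMat w n 1 0 := by
  simp [prodMat, cfMat, Matrix.mul_apply, Fin.sum_univ_two]

lemma prodMat_zero_zero (w : ℕ → ℕ) : ∀ n, prodMat w n 0 0 = contQ w n
  | 0 => by simp [prodMat, contQ]
  | 1 => by simp [prodMat, contQ, cfMat]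
  | n + 2 => by
    rw [(prodMat_succ_apply w (n + 1)).1, (prodMat_succ_apply w n).2.1, prodMat_zero_zero w (n + 1),
      prodMat_zero_zero w n, contQ]
    push_cast
    ring

lemma det_prodMat (w : ℕ → ℕ) (n : ℕ) : (prodMat w n).det = (-1) ^ n := by
  induction n with
  | zero => simp [prodMat]
  | succ n ih => rw [prodMat, det_mul, ih, cfMat, det_fin_two_of, pow_succ]; ring

lemma prodMat_congr {w v : ℕ → ℕ} (n : ℕ) (h : ∀ i < n, w (i + 1) = v (i + 1)) :
    prodMat w n = prodMat v n := by
  induction n with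
  | zero => rfl
  | succ n ih => rw [prodMat, prodMat, ih fun i hi => h i (by omega), h n (by omega)]

lemma prodMat_add {w v : ℕ → ℕ} (n m : ℕ) (h : ∀ i < m, w (n + i + 1) = v (i + 1)) :
    prodMat w (n + m) = prodMat w n * prodMat v m := by
  induction m with
  | zero => simp [prodMat]
  | succ m ih =>
    rw [← add_assoc, prodMat, prodMat, ih fun i hi => h i (by omega), h m (by omega), mul_assoc]

lemma prodMat_mul_of_periodic {w : ℕ → ℕ} {q : ℕ} (h : ∀ i, w (q + i + 1) = w (i + 1)) (k : ℕ) :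
    prodMat w (k * q) = prodMat w q ^ k := by
  induction k with
  | zero => simp [prodMat]
  | succ k ih =>
    rw [add_mul, one_mul, add_comm, prodMat_add q (k * q) fun i _ => h i, ih, pow_succ']

lemma prodMat_bounds {w : ℕ → ℕ} (hw : ∀ n, 1 ≤ w n) (n : ℕ) :
    1 ≤ prodMat w n 0 0 ∧ 0 ≤ prodMat w n 0 1 ∧ 0 ≤ prodMat w n 1 0 ∧ 0 ≤ prodMat w n 1 1 ∧
    prodMat w n 1 0 ≤ prodMat w n 0 0 ∧ prodMat w n 1 1 ≤ prodMat w n 0 0 ∧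
    prodMat w n 1 0 + prodMat w n 1 1 ≤ prodMat w n 0 0 + prodMat w n 0 1 ∧
    1 ≤ prodMat w n 1 0 + prodMat w n 1 1 := by
  induction n with
  | zero => simp [prodMat]
  | succ n ih =>
    obtain ⟨h1, h2, h3, h4, h5, h6, h7, h8⟩ := ih
    obtain ⟨e1, e2, e3, e4⟩ := prodMat_succ_apply w n
    have hw1 : (1 : ℝ) ≤ w (n + 1) := by exact_mod_cast hw (n + 1)
    rw [e1, e2, e3, e4]
    refine ⟨?_, ?_, ?_, ?_, ?_, ?_, ?_, ?_⟩ <;> nlinarith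

lemma trace_prodMat_pos {w : ℕ → ℕ} (hw : ∀ n, 1 ≤ w n) (n : ℕ) : 0 < (prodMat w n).trace := by
  obtain ⟨h1, -, -, h4, -⟩ := prodMat_bounds hw n
  rw [trace_fin_two]
  linarith

lemma four_mul_det_lt_trace_sq {w : ℕ → ℕ} (hw : ∀ n, 1 ≤ w n) {n : ℕ} (hn : 0 < n) :
    4 * (-1) ^ n < (prodMat w n).trace ^ 2 := by
  rw [← det_prodMat w, det_fin_two, trace_fin_two]
  obtain ⟨m, rfl⟩ := Nat.exists_eq_add_of_lt hn
  rw [zero_add]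
  obtain ⟨h1, h2, h3, h4, h5, h6, h7, h8⟩ := prodMat_bounds hw m
  obtain ⟨-, e2, e3, -⟩ := prodMat_succ_apply w m
  have hw1 : (1 : ℝ) ≤ w (m + 1) := by exact_mod_cast hw (m + 1)
  have p1 : 0 < prodMat w (m + 1) 0 1 := by rw [e2]; linarith
  have p2 : 0 < prodMat w (m + 1) 1 0 := by rw [e3]; nlinarith
  nlinarith [mul_pos p1 p2, sq_nonneg (prodMat w (m + 1) 0 0 - prodMat w (m + 1) 1 1)]

lemma mul_self_fin_two (X : Matrix (Fin 2) (Fin 2) ℝ) : X * X = X.trace • X - X.det • 1 := by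
  ext i j
  fin_cases i <;> fin_cases j <;>
    simp [Matrix.mul_apply, Fin.sum_univ_two, trace_fin_two, det_fin_two] <;> ring

lemma trace_mul_mul_left (X Y : Matrix (Fin 2) (Fin 2) ℝ) :
    (X * (X * Y)).trace = X.trace * (X * Y).trace - X.det * Y.trace := by
  rw [← mul_assoc, mul_self_fin_two, sub_mul, smul_mul, smul_mul, one_mul, trace_sub, trace_smul,
    trace_smul, smul_eq_mul, smul_eq_mul]

lemma trace_mul_mul_right (X Y : Matrix (Fin 2) (Fin 2) ℝ) :
    (X * Y * Y).trace = (X * Y).trace * Y.trace - Y.det * X.trace := by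
  rw [mul_assoc, mul_self_fin_two, mul_sub, Matrix.mul_smul, Matrix.mul_smul, mul_one,
    trace_sub, trace_smul, trace_smul, smul_eq_mul, smul_eq_mul, mul_comm Y.trace]

lemma trace_pow_fin_two {X : Matrix (Fin 2) (Fin 2) ℝ} {u v : ℝ} (ht : X.trace = u + v)
    (hd : X.det = u * v) : ∀ k : ℕ, (X ^ k).trace = u ^ k + v ^ k
  | 0 => by norm_num [trace_fin_two]
  | 1 => by simp [ht]
  | k + 2 => by
    have := trace_mul_mul_left X (X ^ k)
    rw [← pow_succ', ← pow_succ', trace_pow_fin_two ht hd (k + 1), trace_pow_fin_two ht hd k, ht,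
      hd] at this
    rw [this]
    ring

/-- The Lévy constant of a purely periodic continued fraction. -/
lemma HasLevyConstant.eq_of_periodic {w : ℕ → ℕ} (hw : ∀ n, 1 ≤ w n) {q : ℕ} (hq : 0 < q)
    (hper : ∀ i, w (q + i + 1) = w (i + 1)) {l : ℝ} (hl : HasLevyConstant w l) :
    l = logRoot ((-1) ^ q) (prodMat w q).trace / q := by
  obtain ⟨u, hu, hlu, hxu, -⟩ := exists_root (neg_one_pow_eq_or ℝ q) (trace_prodMat_pos hw q)
    (four_mul_det_lt_trace_sq hw hq)
  have hu0 : 0 < u := by linarith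
  have htr := trace_pow_fin_two hxu (by rw [det_prodMat]; field_simp)
  have hv : |(-1 : ℝ) ^ q / u| ≤ 1 := by
    rw [abs_div, abs_pow, abs_neg, abs_one, one_pow, abs_of_pos hu0, div_le_one hu0]
    exact hu.le
  have hQ (k : ℕ) : 1 ≤ (contQ w (k * q) : ℝ) ∧ (u ^ k - 1) / 2 ≤ contQ w (k * q) ∧
      (contQ w (k * q) : ℝ) ≤ u ^ k + 1 := by
    obtain ⟨h1, -, -, h4, -, h6, -⟩ := prodMat_bounds hw (k * q)
    have h := htr k
    have hvk : |((-1 : ℝ) ^ q / u) ^ k| ≤ 1 := by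
      rw [abs_pow]; exact pow_le_one₀ (abs_nonneg _) hv
    rw [← prodMat_mul_of_periodic hper, trace_fin_two] at h
    have := abs_le.1 hvk
    rw [← prodMat_zero_zero]
    exact ⟨h1, by linarith, by linarith⟩
  have hsub : Tendsto (fun k : ℕ => Real.log (contQ w (k * q)) / (k * q : ℕ)) atTop (nhds l) :=
    hl.comp (tendsto_id.atTop_mul_const' hq)
  have hc (c : ℝ) : Tendsto (fun k : ℕ => Real.log u / q + c / (k * q : ℕ)) atTop
      (nhds (Real.log u / q)) := by
    have : Tendsto (fun k : ℕ => c / ((k * q : ℕ) : ℝ)) atTop (nhds 0) :=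
      (tendsto_const_div_atTop_nhds_zero_nat c).comp (tendsto_id.atTop_mul_const' hq)
    simpa using this.const_add (Real.log u / q)
  have hpow : ∀ᶠ k : ℕ in atTop, 2 ≤ u ^ k :=
    (tendsto_pow_atTop_atTop_of_one_lt hu).eventually_ge_atTop 2
  have hform {k : ℕ} (hk : 0 < k) (c : ℝ) :
      Real.log u / q + c / (k * q : ℕ) = (Real.log (u ^ k) + c) / (k * q : ℕ) := by
    have : (k : ℝ) ≠ 0 := by positivity
    rw [Real.log_pow]
    push_cast
    field_simp
  rw [hlu]
  refine tendsto_nhds_unique hsub (tendsto_of_tendsto_of_tendsto_of_le_of_le' (hc (-Real.log 4))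
    (hc (Real.log 2)) ?_ ?_)
  · filter_upwards [hpow, eventually_gt_atTop 0] with k hk hk0
    rw [hform hk0]
    have := (hQ k).2.1
    rw [← sub_eq_add_neg, ← Real.log_div (by positivity) (by norm_num)]
    gcongr
    linarith
  · filter_upwards [hpow, eventually_gt_atTop 0] with k hk hk0
    rw [hform hk0]
    obtain ⟨h1, -, h3⟩ := hQ k
    rw [← Real.log_mul (by positivity) (by norm_num)]
    gcongr
    linarith

lemma one_le_mechWord {a b : ℕ} (ha : 1 ≤ a) (hab : a < b) (θ ρ : ℝ) (n : ℕ) :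
    1 ≤ mechWord a b θ ρ n := by
  unfold mechWord
  split_ifs <;> omega

lemma mechWord_succ (a b p q n : ℕ) :
    mechWord a b ((p : ℝ) / q) 0 (n + 1) = if (n + 1) * p / q = n * p / q then a else b := by
  have h (m : ℕ) : ⌊(m : ℝ) * (p / q) + 0⌋ = ((m * p / q : ℕ) : ℤ) := by
    rw [add_zero, ← mul_div_assoc, ← Nat.cast_mul, ← Nat.floor_div_eq_div (K := ℝ),
      Int.natCast_floor_eq_floor (by positivity)]
  unfold mechWord
  have e : ((n + 1 : ℕ) : ℝ) - 1 = n := by push_cast; ring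
  simp only [e, h, sub_eq_zero, Nat.cast_inj]

lemma mechWord_periodic (a b p : ℕ) {q : ℕ} (hq : 0 < q) (i : ℕ) :
    mechWord a b ((p : ℝ) / q) 0 (q + i + 1) = mechWord a b ((p : ℝ) / q) 0 (i + 1) := by
  have h (m : ℕ) : (q + m) * p / q = p + m * p / q := by
    rw [add_mul, Nat.mul_add_div hq]
  rw [mechWord_succ, mechWord_succ, add_assoc, h, h]
  simp only [Nat.add_left_cancel_iff]

namespace SternBrocot

variable {p q p' q' : ℕ}

lemma mediant_div (h : SternBrocot p q p' q') {n : ℕ} (hn : n ≤ q) :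
    n * (p + p') / (q + q') = n * p / q := by
  have hd := h.det_eq
  have hq := h.pos_left
  have hq' := h.pos_right
  have e := Nat.div_add_mod (n * p) q
  have hr := Nat.mod_lt (n * p) hq
  set m := n * p / q
  set r := n * p % q
  have key : q * (n * (p + p')) = (q + q') * (q * m + r) + n := by
    rw [e]; linear_combination n * hd
  refine Nat.div_eq_of_lt_le (Nat.le_of_mul_le_mul_left ?_ hq)
    (Nat.lt_of_mul_lt_mul_left (a := q) ?_)
  · rw [key]; nlinarith
  · rw [key]; nlinarith

lemma mediant_div_add (h : SternBrocot p q p' q') {n : ℕ} (hn : n ≤ q') :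
    (q + n) * (p + p') / (q + q') = p + n * p' / q' := by
  have hd := h.det_eq
  have hq := h.pos_left
  have hq' := h.pos_right
  have e := Nat.div_add_mod (n * p') q'
  have hr := Nat.mod_lt (n * p') hq'
  set m := n * p' / q'
  set r := n * p' % q'
  have key : q' * ((q + n) * (p + p')) + (q + n) = (q + q') * (q' * p + 1 + (q' * m + r)) := by
    rw [e]; linear_combination (q + n) * hd.symm + (q + q') * hd
  refine Nat.div_eq_of_lt_le (Nat.le_of_mul_le_mul_left ?_ hq')
    (Nat.lt_of_mul_lt_mul_left (a := q') ?_)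
  · nlinarith
  · nlinarith

end SternBrocot

/-- The matrix `X_{p/q}` attached to the lower Christoffel word of slope `p/q`. -/
noncomputable def christoffelMat (a b p q : ℕ) : Matrix (Fin 2) (Fin 2) ℝ :=
  prodMat (mechWord a b ((p : ℝ) / q) 0) q

lemma SternBrocot.christoffelMat_mediant {p q p' q' : ℕ} (h : SternBrocot p q p' q') (a b : ℕ) :
    christoffelMat a b (p + p') (q + q') = christoffelMat a b p q * christoffelMat a b p' q' := by
  unfold christoffelMat
  rw [prodMat_add (v := mechWord a b ((p' : ℝ) / q') 0), prodMat_congr q]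
  · intro i hi
    rw [mechWord_succ, mechWord_succ, h.mediant_div hi, h.mediant_div hi.le]
  · intro i hi
    rw [mechWord_succ, mechWord_succ, add_assoc, h.mediant_div_add hi, h.mediant_div_add hi.le]
    simp only [Nat.add_left_cancel_iff]

lemma det_christoffelMat (a b p q : ℕ) : (christoffelMat a b p q).det = (-1) ^ q :=
  det_prodMat _ _

lemma isTraceTree_christoffelMat (a b : ℕ) :
    IsTraceTree a b fun p q => (christoffelMat a b p q).trace := by
  have h01 : christoffelMat a b 0 1 = cfMat a := by
    simp [christoffelMat, prodMat, mechWord]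
  have h11 : christoffelMat a b 1 1 = cfMat b := by
    simp [christoffelMat, prodMat, mechWord]
  refine ⟨?_, ?_, ?_, fun {p q p' q'} h => ?_, fun {p q p' q'} h => ?_⟩
  · simp [h01, cfMat, trace_fin_two]
  · simp [h11, cfMat, trace_fin_two]
  · have := SternBrocot.root.christoffelMat_mediant a b
    rw [h01, h11] at this
    simp only [zero_add, one_add_one_eq_two] at this
    rw [this, cfMat, cfMat, trace_fin_two]
    simp [Matrix.mul_apply, Fin.sum_univ_two]
    ring
  · rw [h.left.christoffelMat_mediant, h.christoffelMat_mediant, trace_mul_mul_left,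
      det_christoffelMat]
  · rw [h.right.christoffelMat_mediant, h.christoffelMat_mediant, trace_mul_mul_right,
      det_christoffelMat]

lemma HasLevyConstant.eq_logRoot_div {a b p q : ℕ} (ha : 1 ≤ a) (hab : a < b) (hq : 0 < q) {l : ℝ}
    (hl : HasLevyConstant (mechWord a b ((p : ℝ) / q) 0) l) :
    l = logRoot ((-1) ^ q) (christoffelMat a b p q).trace / q :=
  hl.eq_of_periodic (one_le_mechWord ha hab _ _) hq (mechWord_periodic a b p hq)

lemma exists_lowest_terms {p q : ℕ} (hq : 1 ≤ q) (hp : p ≤ q) : ∃ m n : ℕ, 0 < n ∧ m ≤ n ∧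
    m.Coprime n ∧ (p : ℝ) / q = (m : ℝ) / n := by
  have hg : 0 < p.gcd q := Nat.gcd_pos_of_pos_right p hq
  refine ⟨p / p.gcd q, q / p.gcd q, Nat.div_pos (Nat.gcd_le_right p hq) hg,
    Nat.div_le_div_right hp, Nat.coprime_div_gcd_div_gcd hg, ?_⟩
  have hg0 : ((p.gcd q : ℕ) : ℝ) ≠ 0 := by positivity
  rw [Nat.cast_div (Nat.gcd_dvd_left p q) hg0, Nat.cast_div (Nat.gcd_dvd_right p q) hg0,
    div_div_div_cancel_right₀ hg0]

/-- Proposition `Prop:monotonicity`. For `1 ≤ a < b` and rationals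
`p/q < p'/q'` in `[0,1]`, one has `𝓛(α_{p/q}) < 𝓛(α_{p'/q'})`, where
`α_{p/q} = [0; \overline{w_{p/q}}]` has the purely periodic sequence of partial
quotients `s_{p/q, 0}` obtained by repeating the lower Christoffel word `w_{p/q}`. -/
theorem stmt14 (a b : ℕ) (ha : 1 ≤ a) (hab : a < b)
    (p q p' q' : ℕ) (hq : 1 ≤ q) (hq' : 1 ≤ q') (hp : p ≤ q) (hp' : p' ≤ q')
    (hlt : (p : ℝ) / q < (p' : ℝ) / q')
    (ℓ ℓ' : ℝ)
    (hℓ : HasLevyConstant (mechWord a b ((p : ℝ) / q) 0) ℓ)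
    (hℓ' : HasLevyConstant (mechWord a b ((p' : ℝ) / q') 0) ℓ') :
    ℓ < ℓ' := by
  obtain ⟨m, n, hn, hmn, hc, e⟩ := exists_lowest_terms hq hp
  obtain ⟨m', n', hn', hmn', hc', e'⟩ := exists_lowest_terms hq' hp'
  rw [e, e', div_lt_div_iff₀ (by positivity) (by positivity)] at hlt
  rw [e] at hℓ
  rw [e'] at hℓ'
  rw [hℓ.eq_logRoot_div ha hab hn, hℓ'.eq_logRoot_div ha hab hn']
  exact SternBrocot.lt_of_lt
    (f := fun p q => logRoot ((-1) ^ q) (christoffelMat a b p q).trace / q)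
    (SternBrocot.logRoot_div_lt (by exact_mod_cast ha) (by exact_mod_cast hab)
      (isTraceTree_christoffelMat a b)) (max n n') (max n n') SternBrocot.root (by omega) hn hn'
    (le_max_left n n') (le_max_right n n') hc hc' (by omega) (by omega) (by exact_mod_cast hlt)
end

section
/- Let a, b be distinct positive integers, and let ξ_{a,b} = [0; a, b, a, a, b, b, b, b, a, a, ...] be the real number whose first partial quotient is a and, for each n ≥ 0, whose partial quotients with index from 2^n + 1 up to 2^{n+1} are all equal to b if n is even and all equal to a if n is odd. Then ξ_{a,b} does not have a Lévy constant: the sequence ((log Q_n)/n)_{n≥1} does not converge. -/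
open Filter Real Matrix

/-- The dominant root of `x ^ 2 = c * x + 1`. -/
noncomputable def contRoot (c : ℕ) : ℝ := ((c : ℝ) + √((c : ℝ) ^ 2 + 4)) / 2

lemma contRoot_sq (c : ℕ) : contRoot c ^ 2 = c * contRoot c + 1 := by
  have h := Real.sq_sqrt (show (0 : ℝ) ≤ (c : ℝ) ^ 2 + 4 by positivity)
  unfold contRoot
  linear_combination h / 4

lemma one_le_contRoot (c : ℕ) : 1 ≤ contRoot c := by
  have h : (2 : ℝ) ≤ √((c : ℝ) ^ 2 + 4) := Real.le_sqrt_of_sq_le (by nlinarith [sq_nonneg (c : ℝ)])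
  have hc : (0 : ℝ) ≤ c := c.cast_nonneg
  unfold contRoot
  linarith

lemma contRoot_injective : Function.Injective contRoot := by
  intro a b h
  have ha := contRoot_sq a
  have hb := contRoot_sq b
  have hpos : 0 < contRoot b := zero_lt_one.trans_le (one_le_contRoot b)
  rw [h] at ha
  have : (a : ℝ) = b := mul_right_cancel₀ hpos.ne' (by linarith)
  exact_mod_cast this

lemma contQ_pos {w : ℕ → ℕ} (hw : ∀ i, 1 ≤ i → 0 < w i) (n : ℕ) : 0 < contQ w n := by
  induction n using Nat.twoStepInduction with
  | zero => simp [contQ]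
  | one => simpa [contQ] using hw 1 le_rfl
  | more n ih _ => rw [contQ]; positivity

lemma contQ_le_succ {w : ℕ → ℕ} (hw : ∀ i, 1 ≤ i → 0 < w i) (n : ℕ) :
    contQ w n ≤ contQ w (n + 1) := by
  cases n with
  | zero => simpa [contQ, Nat.one_le_iff_ne_zero] using (hw 1 le_rfl).ne'
  | succ n =>
    rw [contQ]
    exact (Nat.le_mul_of_pos_left _ (hw _ (by omega))).trans (Nat.le_add_right _ _)

/-- Over a block of partial quotients equal to `c`, the denominators `contQ` grow like the powers
of `contRoot c`, up to bounded factors. -/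
lemma contQ_block_bounds {w : ℕ → ℕ} (hw : ∀ i, 1 ≤ i → 0 < w i) {c m N : ℕ} (hc : 0 < c)
    (hm : 1 ≤ m) (hblock : ∀ i, m + 1 ≤ i → i ≤ m + N → w i = c) (j : ℕ) (hj : j ≤ N) :
    contQ w m * contRoot c ^ j ≤ contRoot c * contQ w (m + j) ∧
      (contQ w (m + j) : ℝ) ≤ (c + 1) * (contQ w m * contRoot c ^ j) := by
  have hr := one_le_contRoot c
  have hr2 := contRoot_sq c
  have hc' : (1 : ℝ) ≤ c := by exact_mod_cast hc
  have hQ : (0 : ℝ) < contQ w m := by exact_mod_cast contQ_pos hw m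
  induction j using Nat.twoStepInduction with
  | zero =>
    simp only [pow_zero, mul_one, add_zero]
    constructor <;> nlinarith
  | one =>
    obtain ⟨k, rfl⟩ := Nat.exists_eq_add_of_le' hm
    have hrec : (contQ w (k + 1 + 1) : ℝ) = c * contQ w (k + 1) + contQ w k := by
      rw [contQ, hblock (k + 2) (by omega) (by omega)]
      push_cast
      ring
    have hk : (contQ w k : ℝ) ≤ contQ w (k + 1) := by exact_mod_cast contQ_le_succ hw k
    have hk0 : (0 : ℝ) ≤ contQ w k := Nat.cast_nonneg _
    rw [hrec, pow_one]
    constructor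
    · have : (contQ w (k + 1) : ℝ) ≤ c * contQ w (k + 1) + contQ w k := by nlinarith
      nlinarith
    · have : (contQ w (k + 1) : ℝ) ≤ contQ w (k + 1) * contRoot c := by nlinarith
      nlinarith
  | more j ih₁ ih₂ =>
    obtain ⟨l₁, u₁⟩ := ih₁ (by omega)
    obtain ⟨l₂, u₂⟩ := ih₂ (by omega)
    have hrec : (contQ w (m + (j + 2)) : ℝ) = c * contQ w (m + (j + 1)) + contQ w (m + j) := by
      rw [← add_assoc, contQ, add_assoc m j 2, hblock (m + (j + 2)) (by omega) (by omega)]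
      push_cast
      rfl
    have hpow : contRoot c ^ (j + 2) = c * contRoot c ^ (j + 1) + contRoot c ^ j := by
      rw [pow_add, hr2]
      ring
    rw [hrec, hpow]
    have l₃ := mul_le_mul_of_nonneg_left l₂ (zero_le_one.trans hc')
    have u₃ := mul_le_mul_of_nonneg_left u₂ (zero_le_one.trans hc')
    constructor <;> linarith

lemma abs_log_contQ_block_sub_le {w : ℕ → ℕ} (hw : ∀ i, 1 ≤ i → 0 < w i) {c m N : ℕ} (hc : 0 < c)
    (hm : 1 ≤ m) (hblock : ∀ i, m + 1 ≤ i → i ≤ m + N → w i = c) :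
    |Real.log (contQ w (m + N)) - Real.log (contQ w m) - N * Real.log (contRoot c)| ≤
      Real.log (contRoot c) + Real.log (c + 1) := by
  obtain ⟨l, u⟩ := contQ_block_bounds hw hc hm hblock N le_rfl
  have hr := one_le_contRoot c
  have hr0 : 0 < contRoot c := zero_lt_one.trans_le hr
  have hQ : (0 : ℝ) < contQ w m := by exact_mod_cast contQ_pos hw m
  have hQN : (0 : ℝ) < contQ w (m + N) := by exact_mod_cast contQ_pos hw (m + N)
  have hc1 : (1 : ℝ) ≤ c + 1 := by simp
  have l' := Real.log_le_log (by positivity) l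
  have u' := Real.log_le_log hQN u
  rw [Real.log_mul hQ.ne' (by positivity), Real.log_mul hr0.ne' hQN.ne', Real.log_pow] at l'
  rw [Real.log_mul (by positivity) (by positivity), Real.log_mul hQ.ne' (by positivity),
    Real.log_pow] at u'
  have := Real.log_nonneg hr
  have := Real.log_nonneg hc1
  rw [abs_le]
  constructor <;> linarith

/-- If `w` equals `c n` on the dyadic block `(2 ^ n, 2 ^ (n + 1)]` and takes boundedly many values,
a Lévy constant of `w` is the limit of `log (contRoot (c n))`. -/
lemma HasLevyConstant.tendsto_log_contRoot {w c : ℕ → ℕ} {ℓ B : ℝ} (h : HasLevyConstant w ℓ)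
    (hw : ∀ i, 1 ≤ i → 0 < w i) (hc : ∀ n, 0 < c n)
    (hblock : ∀ n i, 2 ^ n + 1 ≤ i → i ≤ 2 ^ (n + 1) → w i = c n)
    (hB : ∀ n, Real.log (contRoot (c n)) + Real.log (c n + 1) ≤ B) :
    Tendsto (fun n => Real.log (contRoot (c n))) atTop (nhds ℓ) := by
  have hu : Tendsto (fun n : ℕ => Real.log (contQ w (2 ^ n)) / (2 ^ n : ℝ)) atTop (nhds ℓ) := by
    refine (h.comp (tendsto_pow_atTop_atTop_of_one_lt one_lt_two)).congr fun n => ?_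
    simp
  have hlim := ((hu.comp (tendsto_add_atTop_nat 1)).const_mul 2).sub hu
  have herr : Tendsto (fun n : ℕ => B / (2 : ℝ) ^ n) atTop (nhds 0) :=
    (tendsto_pow_atTop_atTop_of_one_lt one_lt_two).const_div_atTop B
  have hdiff : Tendsto (fun n : ℕ => 2 * (Real.log (contQ w (2 ^ (n + 1))) / (2 : ℝ) ^ (n + 1)) -
      Real.log (contQ w (2 ^ n)) / (2 : ℝ) ^ n - Real.log (contRoot (c n))) atTop (nhds 0) := by
    refine squeeze_zero_norm (fun n => ?_) herr
    have hb := abs_log_contQ_block_sub_le hw (hc n) (Nat.one_le_two_pow (n := n)) (N := 2 ^ n)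
      fun i h₁ h₂ => hblock n i h₁ (by rw [pow_succ]; omega)
    have hp : (0 : ℝ) < 2 ^ n := by positivity
    rw [← mul_two, ← pow_succ] at hb
    push_cast at hb
    rw [Real.norm_eq_abs, le_div_iff₀ hp, ← abs_of_pos hp, ← abs_mul, abs_of_pos hp]
    refine le_trans (le_of_eq ?_) (hb.trans (hB n))
    congr 1
    field_simp
    ring
  have := hlim.sub hdiff
  rw [two_mul, add_sub_cancel_right, sub_zero] at this
  refine this.congr fun n => ?_
  simp only [Function.comp_apply]
  ring

/-- The real number `ξ_{a,b} = [0; a, b, a, a, b, b, b, b, a, a, …]`,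
whose first partial quotient is `a` and whose partial quotients with index from
`2^n + 1` to `2^{n+1}` all equal `b` for even `n` and `a` for odd `n`, has no Lévy
constant. -/
theorem stmt17 (a b : ℕ) (ha : 0 < a) (hb : 0 < b) (hab : a ≠ b)
    (w : ℕ → ℕ) (hw1 : w 1 = a)
    (hw : ∀ n i : ℕ, 2 ^ n + 1 ≤ i → i ≤ 2 ^ (n + 1) →
      w i = if Even n then b else a) :
    ¬ ∃ ℓ : ℝ, HasLevyConstant w ℓ := by
  rintro ⟨ℓ, h⟩
  have hc : ∀ n : ℕ, 0 < if Even n then b else a := fun n => by split_ifs <;> assumption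
  have hpos : ∀ i, 1 ≤ i → 0 < w i := by
    intro i hi
    obtain rfl | hi := hi.eq_or_lt
    · rwa [hw1]
    · have h₁ := Nat.pow_log_le_self 2 (show i - 1 ≠ 0 by omega)
      have h₂ := Nat.lt_pow_succ_log_self one_lt_two (i - 1)
      rw [hw (Nat.log 2 (i - 1)) i (by omega) (by simp only [Nat.succ_eq_add_one] at h₂; omega)]
      exact hc _
  have hlim := h.tendsto_log_contRoot hpos hc hw
    (B := max (Real.log (contRoot b) + Real.log (b + 1))
      (Real.log (contRoot a) + Real.log (a + 1)))
    fun n => by split_ifs <;> simp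
  have he : Tendsto (fun n : ℕ => 2 * n) atTop atTop :=
    tendsto_atTop_mono (fun n => by simp only [id]; omega) tendsto_id
  have ho : Tendsto (fun n : ℕ => 2 * n + 1) atTop atTop :=
    tendsto_atTop_mono (fun n => by simp only [id]; omega) tendsto_id
  have hℓb : Real.log (contRoot b) = ℓ := by
    refine tendsto_nhds_unique (tendsto_const_nhds.congr fun n => ?_) (hlim.comp he)
    simp
  have hℓa : Real.log (contRoot a) = ℓ := by
    refine tendsto_nhds_unique (tendsto_const_nhds.congr fun n => ?_) (hlim.comp ho)
    simp
  have hroot (c : ℕ) : 0 < contRoot c := zero_lt_one.trans_le (one_le_contRoot c)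
  exact hab (contRoot_injective
    (Real.log_injOn_pos (hroot a) (hroot b) (hℓa.trans hℓb.symm)))
end
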